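/- arXiv:1811.04334 — 7 statements merged into one kernel-verified Lean document; each statement's English description precedes it below -/
import Mathlib

section
/- Let M be a finite monoid, K a subgroup of the group of units of M, F a field whose characteristic does not divide |K|, and (π, V) an irreducible representation of M over F with V^K ≠ {0}. Then for every nonzero u ∈ V^K and every v ∈ V^K, there exists a K-biinvariant function φ : M → F (i.e. φ(k₁mk₂) = φ(m) for all k₁, k₂ ∈ K, m ∈ M) such that π(φ)u = v, where π(φ)u = Σ_{x∈M} φ(x)π(x)u. -/
open Submodule in
/-- In an irreducible representation of a finite monoid, every vector is obtained from a given
nonzero vector by acting with some function on the monoid. -/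
lemma exists_sum_smul_apply_eq {M F V : Type*} [Monoid M] [Fintype M] [Field F]
    [AddCommGroup V] [Module F V] (π : M →* Module.End F V)
    (hirr : ∀ p : Submodule F V, (∀ m : M, ∀ w ∈ p, π m w ∈ p) → p = ⊥ ∨ p = ⊤)
    {u : V} (hu : u ≠ 0) (v : V) : ∃ f : M → F, ∑ x, f x • π x u = v := by
  have humem : u ∈ span F (Set.range fun x => π x u) := subset_span ⟨1, by simp⟩
  have hinv : ∀ m : M, ∀ w ∈ span F (Set.range fun x => π x u),
      π m w ∈ span F (Set.range fun x => π x u) := by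
    intro m w hw
    induction hw using span_induction with
    | mem w hw =>
      obtain ⟨x, rfl⟩ := hw
      exact subset_span ⟨m * x, by simp⟩
    | zero => simp
    | add a b _ _ ha hb => simpa using add_mem ha hb
    | smul c a _ ha => simpa using smul_mem _ c ha
  rcases hirr _ hinv with h | h
  · rw [h, mem_bot] at humem
    exact absurd humem hu
  · exact (mem_span_range_iff_exists_fun F).1 (h ▸ mem_top)

/-- Translating a function on both sides by units that fix `u` and `v` respectively does not
change the fact that it carries `u` to `v`. -/
lemma sum_translate_smul_apply {M F V : Type*} [Monoid M] [Fintype M] [Field F]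
    [AddCommGroup V] [Module F V] (π : M →* Module.End F V) {u v : V} {f : M → F}
    (hf : ∑ x, f x • π x u = v) {a b : Mˣ} (ha : π a v = v) (hb : π b u = u) :
    ∑ x, f (a * x * b) • π x u = v := by
  have hinj : Function.Injective (π (a : M)) :=
    Function.LeftInverse.injective (g := π ((a⁻¹ : Mˣ) : M)) fun w => by
      rw [← Module.End.mul_apply, ← map_mul, Units.inv_mul, map_one, Module.End.one_apply]
  apply hinj
  rw [ha]
  conv_rhs => rw [← hf]
  rw [map_sum]
  refine Fintype.sum_equiv (a.mulLeft.trans b.mulRight) _ _ fun x => ?_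
  simp [hb]


/-- Let `M` be a finite monoid, `K` a subgroup of the unit group of `M`, `F` a field whose
characteristic does not divide `|K|`, and `(π, V)` an irreducible representation of `M` over `F`
with a nonzero `K`-fixed vector.  Then for every nonzero `u ∈ V^K` and every `v ∈ V^K` there is a
`K`-biinvariant function `φ : M → F` with `π(φ)u = v`, where `π(φ) = ∑_{x ∈ M} φ(x) • π(x)`. -/
theorem exists_biinvariant_carrying_fixed_vector {M : Type*} [Monoid M] [Fintype M]
    {F : Type*} [Field F] {V : Type*} [AddCommGroup V] [Module F V]
    (π : M →* Module.End F V) (K : Subgroup Mˣ)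
    (hchar : ¬ (ringChar F ∣ Nat.card K))
    (hnontriv : Nontrivial V)
    (hirr : ∀ p : Submodule F V, (∀ m : M, ∀ w ∈ p, π m w ∈ p) → p = ⊥ ∨ p = ⊤)
    (u : V) (hu : u ≠ 0) (huK : ∀ k : K, π ((k : Mˣ) : M) u = u)
    (v : V) (hv : ∀ k : K, π ((k : Mˣ) : M) v = v) :
    ∃ φ : M → F,
      (∀ (k₁ k₂ : K) (m : M),
        φ (((k₁ : Mˣ) : M) * m * ((k₂ : Mˣ) : M)) = φ m) ∧
      (∑ x : M, φ x • π x) u = v := by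
  obtain ⟨f, hf⟩ := exists_sum_smul_apply_eq π hirr hu v
  have : Fintype K := Fintype.ofFinite K
  have hK : (Nat.card K : F) ≠ 0 := fun h => hchar ((ringChar.spec F _).1 h)
  refine ⟨fun m => ((Nat.card K : F) * Nat.card K)⁻¹ *
    ∑ a : K, ∑ b : K, f (((a : Mˣ) : M) * m * ((b : Mˣ) : M)), fun k₁ k₂ m => ?_, ?_⟩
  · refine congrArg _ ?_
    refine Fintype.sum_equiv (Equiv.mulRight k₁) _ _ fun a => ?_
    refine Fintype.sum_equiv (Equiv.mulLeft k₂) _ _ fun b => ?_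
    simp [mul_assoc]
  · have key : ∀ a b : K, ∑ x, f (((a : Mˣ) : M) * x * ((b : Mˣ) : M)) • π x u = v :=
      fun a b => sum_translate_smul_apply π hf (hv a) (huK b)
    have hsum : ∑ x, ∑ a : K, ∑ b : K,
        f (((a : Mˣ) : M) * x * ((b : Mˣ) : M)) • π x u = ∑ _a : K, ∑ _b : K, v := by
      rw [Finset.sum_comm]
      refine Finset.sum_congr rfl fun a _ => ?_
      rw [Finset.sum_comm]
      exact Finset.sum_congr rfl fun b _ => key a b
    simp only [LinearMap.sum_apply, LinearMap.smul_apply, mul_smul, Finset.sum_smul,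
      ← Finset.smul_sum]
    rw [hsum]
    simp only [Finset.sum_const, Finset.card_univ, ← Nat.card_eq_fintype_card,
      ← Nat.cast_smul_eq_nsmul F, ← mul_smul]
    rw [inv_mul_cancel₀ (mul_ne_zero hK hK), one_smul]
end

section
/- Let M be a finite monoid, K a subgroup of the group of units of M, F a field whose characteristic does not divide |K|, and (π, V) an irreducible representation of M over F with V^K ≠ {0}. Let H_K be the F-algebra of K-biinvariant functions φ : M → F under convolution (φ*ψ)(m) = Σ_{yz=m} φ(y)ψ(z), acting on V^K by φ · v = Σ_{x∈M} φ(x)π(x)v. Then V^K is a simple (irreducible) H_K-module. -/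
open Classical in
/-- The function counting the ways to write `x` as `k₁ * m * k₂` with `k₁, k₂ ∈ K`. -/
noncomputable def doubleCosetCount {M : Type*} [Monoid M] (F : Type*) [Field F]
    (K : Subgroup Mˣ) [Fintype K] (m x : M) : F :=
  ∑ k : K × K, if ((k.1 : Mˣ) : M) * m * ((k.2 : Mˣ) : M) = x then 1 else 0

theorem doubleCosetCount_mul_mul {M : Type*} [Monoid M] (F : Type*) [Field F]
    (K : Subgroup Mˣ) [Fintype K] (m : M) (a b : K) (x : M) :
    doubleCosetCount F K m (((a : Mˣ) : M) * x * ((b : Mˣ) : M)) = doubleCosetCount F K m x := by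
  classical
  unfold doubleCosetCount
  symm
  refine Fintype.sum_equiv ((Equiv.mulLeft a).prodCongr (Equiv.mulRight b)) _ _ fun k => ?_
  have h : ((a : Mˣ) : M) * (((k.1 : Mˣ) : M) * m * ((k.2 : Mˣ) : M)) * ((b : Mˣ) : M) =
      ((a : Mˣ) : M) * x * ((b : Mˣ) : M) ↔ ((k.1 : Mˣ) : M) * m * ((k.2 : Mˣ) : M) = x := by
    rw [Units.mul_left_inj, Units.mul_right_inj]
  simp only [← h]
  simp [mul_assoc]

theorem sum_doubleCosetCount_smul {M : Type*} [Monoid M] [Fintype M] {F : Type*} [Field F]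
    {W : Type*} [AddCommGroup W] [Module F W] (K : Subgroup Mˣ) [Fintype K] (m : M) (f : M → W) :
    ∑ x, doubleCosetCount F K m x • f x =
      ∑ k₁ : K, ∑ k₂ : K, f (((k₁ : Mˣ) : M) * m * ((k₂ : Mˣ) : M)) := by
  classical
  simp only [doubleCosetCount, Finset.sum_smul, ite_smul, one_smul, zero_smul]
  rw [Finset.sum_comm, Fintype.sum_prod_type]
  simp

/-- Let `M` be a finite monoid, `K` a subgroup of the unit group of `M`, `F` a field whose
characteristic does not divide `|K|`, and `(π, V)` an irreducible representation of `M` over `F`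
with `V^K ≠ 0`.  Then `V^K` is simple as a module over the algebra `H_K` of `K`-biinvariant
functions `M → F` acting by `φ • v = ∑_{x ∈ M} φ(x) • π(x) v`: every `F`-subspace of `V^K`
stable under all these operators is `0` or all of `V^K`. -/
theorem fixedSpace_simple_over_biinvariant_algebra {M : Type*} [Monoid M] [Fintype M]
    {F : Type*} [Field F] {V : Type*} [AddCommGroup V] [Module F V]
    (π : M →* Module.End F V) (K : Subgroup Mˣ)
    (hchar : ¬ (ringChar F ∣ Nat.card K))
    (hnontriv : Nontrivial V)
    (hirr : ∀ p : Submodule F V, (∀ m : M, ∀ w ∈ p, π m w ∈ p) → p = ⊥ ∨ p = ⊤)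
    (VK : Submodule F V)
    (hVK : ∀ w : V, w ∈ VK ↔ ∀ k : K, π ((k : Mˣ) : M) w = w)
    (hVKne : VK ≠ ⊥) :
    ∀ p : Submodule F V, p ≤ VK →
      (∀ φ : M → F,
        (∀ (k₁ k₂ : K) (m : M),
          φ (((k₁ : Mˣ) : M) * m * ((k₂ : Mˣ) : M)) = φ m) →
        ∀ w ∈ p, (∑ x : M, φ x • π x) w ∈ p) →
      p = ⊥ ∨ p = VK := by
  intro p hp hstable
  refine or_iff_not_imp_left.2 fun hp0 => le_antisymm hp fun v hv => ?_
  have : Fintype K := Fintype.ofFinite K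
  have hcard : (Fintype.card K : F) ≠ 0 := by
    rwa [Ne, ringChar.spec, ← Nat.card_eq_fintype_card]
  have sum_fixed {w : V} (hw : w ∈ VK) :
      ∑ k : K, π ((k : Mˣ) : M) w = (Fintype.card K : F) • w := by
    rw [Finset.sum_congr rfl fun k _ => (hVK w).1 hw k]
    simp [Nat.cast_smul_eq_nsmul]
  -- the translates of `p` span `V`
  have hspan : Submodule.span F {u | ∃ m : M, ∃ w ∈ p, π m w = u} = ⊤ := by
    refine (hirr _ fun m u hu => ?_).resolve_left fun h => hp0 ?_
    · refine Submodule.span_induction ?_ ?_ ?_ ?_ hu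
      · rintro _ ⟨n, w, hw, rfl⟩
        exact Submodule.subset_span ⟨m * n, w, hw, by simp⟩
      · simp
      · intro x y _ _ hx hy
        simpa using add_mem hx hy
      · intro c x _ hx
        simpa using Submodule.smul_mem _ c hx
    · rw [Submodule.span_eq_bot] at h
      exact (Submodule.eq_bot_iff p).2 fun w hw => h w ⟨1, w, hw, by simp⟩
  -- averaging over `K` maps every translate of `p` back into `p`
  have havg : ⊤ ≤ p.comap (∑ k : K, π ((k : Mˣ) : M)) := by
    rw [← hspan, Submodule.span_le]
    rintro _ ⟨m, w, hw, rfl⟩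
    have h := hstable (doubleCosetCount F K m) (doubleCosetCount_mul_mul F K m) w hw
    have h_sum : (∑ x, doubleCosetCount F K m x • π x) w =
        (Fintype.card K : F) • (∑ k : K, π ((k : Mˣ) : M)) (π m w) := by
      rw [sum_doubleCosetCount_smul]
      simp only [LinearMap.sum_apply, map_mul, Module.End.mul_apply, ← map_sum,
        sum_fixed (hp hw), map_smul, Finset.smul_sum]
    rw [h_sum] at h
    exact (Submodule.smul_mem_iff p hcard).1 h
  have hmem : (∑ k : K, π ((k : Mˣ) : M)) v ∈ p := havg Submodule.mem_top
  rw [LinearMap.sum_apply, sum_fixed hv] at hmem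
  exact (Submodule.smul_mem_iff p hcard).1 hmem
end

section
/- Let F be a field, R an F-algebra, and N₁, N₂ simple R-modules that are finite-dimensional as F-vector spaces. Suppose there exist F-linear functionals L_i : N_i → F and elements n_i ∈ N_i with L_i(n_i) ≠ 0 and L₁(r·n₁) = L₂(r·n₂) for all r ∈ R. Then N₁ ≅ N₂ as R-modules. -/
/-- If two functionals agree along the orbits of `n₁` and `n₂` and do not vanish at `n₂`, where `n₂`
lies in a simple module, then every element of `R` killing `n₁` kills `n₂`. -/
theorem ker_toSpanSingleton_le_of_shared_functional {R A N₁ N₂ : Type*} [Ring R] [Zero A]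
    [AddCommGroup N₁] [AddCommGroup N₂] [Module R N₁] [Module R N₂] [IsSimpleModule R N₂]
    {f₁ : N₁ → A} {f₂ : N₂ → A} {n₁ : N₁} {n₂ : N₂} (hf₁ : f₁ 0 = 0) (h₂ : f₂ n₂ ≠ 0)
    (h : ∀ r : R, f₁ (r • n₁) = f₂ (r • n₂)) :
    LinearMap.ker (LinearMap.toSpanSingleton R N₁ n₁) ≤
      LinearMap.ker (LinearMap.toSpanSingleton R N₂ n₂) := by
  intro r hr
  rw [LinearMap.mem_ker, LinearMap.toSpanSingleton_apply] at hr ⊢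
  by_contra hne
  obtain ⟨s, hs⟩ := IsSimpleModule.toSpanSingleton_surjective R hne n₂
  rw [LinearMap.toSpanSingleton_apply, ← mul_smul] at hs
  apply h₂
  rw [← hs, ← h, mul_smul, hr, smul_zero, hf₁]

/-- Let `F` be a field, `R` an `F`-algebra, and `N₁, N₂` simple `R`-modules that are
finite-dimensional as `F`-vector spaces.  If there are `F`-linear functionals `Lᵢ : Nᵢ → F` and
elements `nᵢ ∈ Nᵢ` with `Lᵢ(nᵢ) ≠ 0` and `L₁(r • n₁) = L₂(r • n₂)` for all `r ∈ R`, then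
`N₁ ≅ N₂` as `R`-modules. -/
theorem simple_modules_iso_of_shared_functional {F : Type*} [Field F]
    {R : Type*} [Ring R] [Algebra F R]
    {N₁ N₂ : Type*} [AddCommGroup N₁] [AddCommGroup N₂]
    [Module R N₁] [Module R N₂] [Module F N₁] [Module F N₂]
    [IsScalarTower F R N₁] [IsScalarTower F R N₂]
    [FiniteDimensional F N₁] [FiniteDimensional F N₂]
    [IsSimpleModule R N₁] [IsSimpleModule R N₂]
    (L₁ : N₁ →ₗ[F] F) (L₂ : N₂ →ₗ[F] F) (n₁ : N₁) (n₂ : N₂)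
    (h₁ : L₁ n₁ ≠ 0) (h₂ : L₂ n₂ ≠ 0)
    (h : ∀ r : R, L₁ (r • n₁) = L₂ (r • n₂)) :
    Nonempty (N₁ ≃ₗ[R] N₂) := by
  have hn₁ : n₁ ≠ 0 := fun e => h₁ (by rw [e, map_zero])
  have hn₂ : n₂ ≠ 0 := fun e => h₂ (by rw [e, map_zero])
  have hker : LinearMap.ker (LinearMap.toSpanSingleton R N₁ n₁) =
      LinearMap.ker (LinearMap.toSpanSingleton R N₂ n₂) :=
    (ker_toSpanSingleton_le_of_shared_functional (map_zero L₁) h₂ h).antisymm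
      (ker_toSpanSingleton_le_of_shared_functional (map_zero L₂) h₁ fun r => (h r).symm)
  exact ⟨(LinearMap.quotKerEquivOfSurjective _
      (IsSimpleModule.toSpanSingleton_surjective R hn₁)).symm.trans
    ((Submodule.quotEquivOfEq _ _ hker).trans
      (LinearMap.quotKerEquivOfSurjective _
        (IsSimpleModule.toSpanSingleton_surjective R hn₂)))⟩
end

section
/- Let M be a finite monoid, F a field, and (π, V), (σ, W) irreducible finite-dimensional representations of M over F. Suppose there exist v ∈ V, v̂ ∈ Hom_F(V,F), w ∈ W, ŵ ∈ Hom_F(W,F) such that the common matrix coefficient is nonzero and v̂(π(m)v) = ŵ(σ(m)w) for all m ∈ M. Then (π, V) ≅ (σ, W), i.e. there is an F-linear isomorphism λ : V → W with λ ∘ π(m) = σ(m) ∘ λ for all m ∈ M. -/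
section OrbitMap

variable {M F V W : Type*} [Monoid M] [Field F] [AddCommGroup V] [Module F V]
  [AddCommGroup W] [Module F W]

/-- The linear map from the free module on `M` to `V` sending the basis vector at `m` to
`π m v`. -/
noncomputable def orbitMap (π : M →* Module.End F V) (v : V) : (M →₀ F) →ₗ[F] V :=
  Finsupp.linearCombination F fun m => π m v

theorem orbitMap_single_one (π : M →* Module.End F V) (v : V) (m : M) :
    orbitMap π v (Finsupp.single m 1) = π m v := by
  simp [orbitMap]

theorem orbitMap_lmapDomain_mul (π : M →* Module.End F V) (v : V) (m : M) (c : M →₀ F) :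
    orbitMap π v (Finsupp.lmapDomain F F (m * ·) c) = π m (orbitMap π v c) := by
  induction c using Finsupp.induction_linear with
  | zero => simp
  | add f g hf hg => rw [map_add, map_add, hf, hg, map_add, map_add]
  | single a b => simp [orbitMap, Finsupp.mapDomain_single]

theorem orbitMap_surjective (π : M →* Module.End F V)
    (hirr : ∀ p : Submodule F V, (∀ m : M, ∀ x ∈ p, π m x ∈ p) → p = ⊥ ∨ p = ⊤)
    {v : V} (hv : v ≠ 0) : Function.Surjective (orbitMap π v) := by
  rw [← LinearMap.range_eq_top]
  refine (hirr _ ?_).resolve_left fun h => hv ?_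
  · rintro m _ ⟨c, rfl⟩
    exact ⟨_, orbitMap_lmapDomain_mul π v m c⟩
  · have hmem : v ∈ LinearMap.range (orbitMap π v) :=
      ⟨Finsupp.single 1 1, by simp [orbitMap_single_one]⟩
    simpa [h] using hmem

theorem apply_orbitMap_eq {π : M →* Module.End F V} {σ : M →* Module.End F W}
    {v : V} {vhat : V →ₗ[F] F} {w : W} {what : W →ₗ[F] F}
    (hcoeff : ∀ m : M, vhat (π m v) = what (σ m w)) (c : M →₀ F) :
    vhat (orbitMap π v c) = what (orbitMap σ w c) := by
  simp [orbitMap, Finsupp.linearCombination_apply, map_finsuppSum, hcoeff]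

theorem ker_orbitMap_le_of_matrix_coefficient
    {π : M →* Module.End F V} {σ : M →* Module.End F W}
    (hirr : ∀ q : Submodule F W, (∀ m : M, ∀ x ∈ q, σ m x ∈ q) → q = ⊥ ∨ q = ⊤)
    {v : V} {vhat : V →ₗ[F] F} {w : W} {what : W →ₗ[F] F}
    (hcoeff : ∀ m : M, vhat (π m v) = what (σ m w)) (hwhat : what ≠ 0) :
    LinearMap.ker (orbitMap π v) ≤ LinearMap.ker (orbitMap σ w) := by
  have hbot : (LinearMap.ker (orbitMap π v)).map (orbitMap σ w) = ⊥ := by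
    refine (hirr _ ?_).resolve_right fun h => hwhat ?_
    · rintro m _ ⟨c, hc, rfl⟩
      refine ⟨_, ?_, orbitMap_lmapDomain_mul σ w m c⟩
      rw [SetLike.mem_coe, LinearMap.mem_ker] at hc ⊢
      rw [orbitMap_lmapDomain_mul, hc, map_zero]
    · ext x
      obtain ⟨c, hc, rfl⟩ : x ∈ (LinearMap.ker (orbitMap π v)).map (orbitMap σ w) :=
        h ▸ Submodule.mem_top
      rw [SetLike.mem_coe, LinearMap.mem_ker] at hc
      rw [← apply_orbitMap_eq hcoeff, hc, map_zero, LinearMap.zero_apply]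
  exact LinearMap.le_ker_iff_map.2 hbot

end OrbitMap


/-- Let `M` be a finite monoid and `(π, V)`, `(σ, W)` irreducible finite-dimensional
representations of `M` over a field `F`.  If there are vectors `v ∈ V`, `w ∈ W` and functionals
`v̂`, `ŵ` with a common matrix coefficient `v̂(π(m)v) = ŵ(σ(m)w)` for all `m ∈ M` which is not
identically zero, then `(π, V) ≅ (σ, W)`. -/
theorem irreducible_iso_of_matrix_coefficient {M : Type*} [Monoid M] [Fintype M]
    {F : Type*} [Field F]
    {V W : Type*} [AddCommGroup V] [Module F V] [AddCommGroup W] [Module F W]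
    [FiniteDimensional F V] [FiniteDimensional F W]
    (π : M →* Module.End F V) (σ : M →* Module.End F W)
    (hVnt : Nontrivial V) (hWnt : Nontrivial W)
    (hVirr : ∀ p : Submodule F V, (∀ m : M, ∀ x ∈ p, π m x ∈ p) → p = ⊥ ∨ p = ⊤)
    (hWirr : ∀ q : Submodule F W, (∀ m : M, ∀ x ∈ q, σ m x ∈ q) → q = ⊥ ∨ q = ⊤)
    (v : V) (vhat : V →ₗ[F] F) (w : W) (what : W →ₗ[F] F)
    (hcoeff : ∀ m : M, vhat (π m v) = what (σ m w))
    (hne : ∃ m : M, vhat (π m v) ≠ 0) :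
    ∃ e : V ≃ₗ[F] W, ∀ (m : M) (x : V), e (π m x) = σ m (e x) := by
  obtain ⟨m₀, hm₀⟩ := hne
  have hv : v ≠ 0 := by rintro rfl; simp at hm₀
  have hvhat : vhat ≠ 0 := by rintro rfl; simp at hm₀
  have hm₁ := hcoeff m₀ ▸ hm₀
  have hw : w ≠ 0 := by rintro rfl; simp at hm₁
  have hwhat : what ≠ 0 := by rintro rfl; simp at hm₁
  have hker : LinearMap.ker (orbitMap π v) = LinearMap.ker (orbitMap σ w) :=
    le_antisymm (ker_orbitMap_le_of_matrix_coefficient hWirr hcoeff hwhat)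
      (ker_orbitMap_le_of_matrix_coefficient hVirr (fun m => (hcoeff m).symm) hvhat)
  have hA := orbitMap_surjective π hVirr hv
  have hB := orbitMap_surjective σ hWirr hw
  let e : V ≃ₗ[F] W := ((orbitMap π v).quotKerEquivOfSurjective hA).symm ≪≫ₗ
    Submodule.quotEquivOfEq _ _ hker ≪≫ₗ (orbitMap σ w).quotKerEquivOfSurjective hB
  have he (c : M →₀ F) : e (orbitMap π v c) = orbitMap σ w c := by
    have hc : ((orbitMap π v).quotKerEquivOfSurjective hA).symm (orbitMap π v c) =
        Submodule.Quotient.mk c := by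
      rw [LinearEquiv.symm_apply_eq]
      rfl
    simp only [e, LinearEquiv.trans_apply, hc]
    rfl
  refine ⟨e, fun m x => ?_⟩
  obtain ⟨c, rfl⟩ := hA x
  rw [← orbitMap_lmapDomain_mul, he, he, orbitMap_lmapDomain_mul]
end

section
/- Let M be a finite monoid, K a subgroup of the group of units of M, and F a field whose characteristic does not divide |K|. Let (π, V) and (σ, W) be irreducible finite-dimensional representations of M over F with V^K ≠ {0} and W^K ≠ {0}. Let H_K be the F-algebra of K-biinvariant functions M → F under convolution, acting on V^K and W^K by φ · v = Σ_{x∈M} φ(x)π(x)v (resp. with σ). If V^K ≅ W^K as H_K-modules, then (π, V) ≅ (σ, W) as representations of M. -/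
open Finset in
/-- Averaging the coefficients of `∑ x, a x • π x` over `K` on both sides amounts, on a
`K`-fixed vector `u` that is an eigenvector of this operator, to scaling by `|K| ^ 2`. -/
lemma sum_biinvariant_smul_apply {M F V : Type*} [Monoid M] [Fintype M] [Field F]
    [AddCommGroup V] [Module F V] (π : M →* Module.End F V) (K : Subgroup Mˣ) [Fintype K]
    (a : M → F) (c : F) {u : V} (hu : ∀ k : K, π ((k : Mˣ) : M) u = u)
    (hau : ∑ x, a x • π x u = c • u) :
    (∑ x : M, (∑ k₁ : K, ∑ k₂ : K, a (((k₁ : Mˣ) : M) * x * ((k₂ : Mˣ) : M))) • π x) u =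
      ((Nat.card K : F) ^ 2 * c) • u := by
  have key (k₁ k₂ : K) :
      ∑ x : M, a (((k₁ : Mˣ) : M) * x * ((k₂ : Mˣ) : M)) • π x u = c • u := by
    have h₁ (x : M) : π x u =
        π (((k₁⁻¹ : K) : Mˣ) : M) (π (((k₁ : Mˣ) : M) * x * ((k₂ : Mˣ) : M)) u) := by
      rw [← Module.End.mul_apply, ← map_mul, mul_assoc, Subgroup.coe_inv, Units.inv_mul_cancel_left,
        map_mul, Module.End.mul_apply, hu]
    calc ∑ x : M, a (((k₁ : Mˣ) : M) * x * ((k₂ : Mˣ) : M)) • π x u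
        = ∑ x : M, a (((k₁ : Mˣ) : M) * x * ((k₂ : Mˣ) : M)) • π (((k₁⁻¹ : K) : Mˣ) : M)
            (π (((k₁ : Mˣ) : M) * x * ((k₂ : Mˣ) : M)) u) :=
          sum_congr rfl fun x _ => by rw [← h₁]
      _ = ∑ x : M, a x • π (((k₁⁻¹ : K) : Mˣ) : M) (π x u) :=
          Equiv.sum_comp ((Units.mulLeft (k₁ : Mˣ)).trans (Units.mulRight (k₂ : Mˣ)))
            fun x => a x • π (((k₁⁻¹ : K) : Mˣ) : M) (π x u)
      _ = π (((k₁⁻¹ : K) : Mˣ) : M) (∑ x, a x • π x u) := by simp [map_sum]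
      _ = c • u := by rw [hau, map_smul, hu]
  simp only [LinearMap.sum_apply, LinearMap.smul_apply, sum_smul]
  rw [sum_comm]
  simp_rw [sum_comm (s := (univ : Finset M)), key]
  simp [← Nat.cast_smul_eq_nsmul F, smul_smul, pow_two, mul_assoc]


/-- Borel–Matsumoto theorem for finite monoids (uniqueness half): let `M` be a finite monoid,
`K` a subgroup of the unit group of `M`, and `F` a field whose characteristic does not divide
`|K|`.  If `(π, V)` and `(σ, W)` are irreducible finite-dimensional representations of `M` over
`F` with nonzero `K`-fixed spaces `V^K`, `W^K`, and if `V^K ≅ W^K` as modules over the algebra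
`H_K` of `K`-biinvariant functions (i.e. there is an `F`-linear bijection `λ : V^K → W^K`
intertwining the operators `π(φ) = ∑_x φ(x)π(x)` and `σ(φ)` for all `K`-biinvariant `φ`),
then `(π, V) ≅ (σ, W)` as representations of `M`. -/
theorem borel_matsumoto_uniqueness {M : Type*} [Monoid M] [Fintype M]
    {F : Type*} [Field F]
    {V W : Type*} [AddCommGroup V] [Module F V] [AddCommGroup W] [Module F W]
    [FiniteDimensional F V] [FiniteDimensional F W]
    (π : M →* Module.End F V) (σ : M →* Module.End F W)
    (K : Subgroup Mˣ) (hchar : ¬ (ringChar F ∣ Nat.card K))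
    (hVnt : Nontrivial V) (hWnt : Nontrivial W)
    (hVirr : ∀ p : Submodule F V, (∀ m : M, ∀ x ∈ p, π m x ∈ p) → p = ⊥ ∨ p = ⊤)
    (hWirr : ∀ q : Submodule F W, (∀ m : M, ∀ x ∈ q, σ m x ∈ q) → q = ⊥ ∨ q = ⊤)
    (VK : Submodule F V)
    (hVK : ∀ x : V, x ∈ VK ↔ ∀ k : K, π ((k : Mˣ) : M) x = x) (hVKne : VK ≠ ⊥)
    (WK : Submodule F W)
    (hWK : ∀ x : W, x ∈ WK ↔ ∀ k : K, σ ((k : Mˣ) : M) x = x) (hWKne : WK ≠ ⊥)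
    (lam : VK ≃ₗ[F] WK)
    (hlam : ∀ φ : M → F,
      (∀ (k₁ k₂ : K) (m : M),
        φ (((k₁ : Mˣ) : M) * m * ((k₂ : Mˣ) : M)) = φ m) →
      ∀ (v v' : VK), ((v' : V) = (∑ x : M, φ x • π x) (v : V)) →
        ((lam v' : W) = (∑ x : M, φ x • σ x) ((lam v : W)))) :
    ∃ e : V ≃ₗ[F] W, ∀ (m : M) (x : V), e (π m x) = σ m (e x) := by
  classical
  have := Fintype.ofFinite K
  have hcard : (Nat.card K : F) ≠ 0 := fun h => hchar ((ringChar.spec F _).1 h)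
  obtain ⟨v, hv, hv0⟩ := VK.ne_bot_iff.1 hVKne
  set w : WK := lam ⟨v, hv⟩ with hw
  have hw0 : (w : W) ≠ 0 := by simpa [hw] using hv0
  have eigen (a : M → F) (c d : F) (hc : ∑ x, a x • π x v = c • v)
      (hd : ∑ x, a x • σ x (w : W) = d • (w : W)) : c = d := by
    have h := hlam
      (fun x => ∑ k₁ : K, ∑ k₂ : K, a (((k₁ : Mˣ) : M) * x * ((k₂ : Mˣ) : M)))
      (fun k₁ k₂ m => by
        rw [← Equiv.sum_comp (Equiv.mulRight k₁)
          fun j => ∑ k : K, a (((j : Mˣ) : M) * m * ((k : Mˣ) : M))]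
        refine Finset.sum_congr rfl fun j _ => ?_
        rw [← Equiv.sum_comp (Equiv.mulLeft k₂)
          fun k => a (((Equiv.mulRight k₁ j : Mˣ) : M) * m * ((k : Mˣ) : M))]
        simp [mul_assoc])
      ⟨v, hv⟩ (((Nat.card K : F) ^ 2 * c) • ⟨v, hv⟩)
      (sum_biinvariant_smul_apply π K a c ((hVK v).1 hv) hc).symm
    rw [← hw, sum_biinvariant_smul_apply σ K a d ((hWK w).1 w.2) hd, map_smul, ← hw,
      Submodule.coe_smul] at h
    exact mul_left_cancel₀ (pow_ne_zero 2 hcard) (smul_left_injective F hw0 h)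
  let N : Submodule F (V × W) := Submodule.span F (Set.range fun x : M => (π x v, σ x (w : W)))
  have memN (z : V × W) (hz : z ∈ N) :
      ∃ a : M → F, ∑ x, a x • π x v = z.1 ∧ ∑ x, a x • σ x (w : W) = z.2 := by
    obtain ⟨a, rfl⟩ := (Submodule.mem_span_range_iff_exists_fun F).1 hz
    exact ⟨a, by simp [Prod.fst_sum], by simp [Prod.snd_sum]⟩
  have invN (m : M) (z : V × W) (hz : z ∈ N) : (π m z.1, σ m z.2) ∈ N := by
    have h : N ≤ N.comap ((π m).prodMap (σ m)) := by
      refine Submodule.span_le.2 ?_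
      rintro _ ⟨x, rfl⟩
      exact Submodule.subset_span ⟨m * x, by simp⟩
    exact h hz
  have vwN : (v, (w : W)) ∈ N := Submodule.subset_span ⟨1, by simp⟩
  have kerV : N.comap (LinearMap.inl F V W) = ⊥ := by
    refine (hVirr _ fun m x hx => by simpa using invN m _ hx).resolve_right fun h => ?_
    have hvN : v ∈ N.comap (LinearMap.inl F V W) := h ▸ Submodule.mem_top
    obtain ⟨a, ha, hb⟩ := memN _ hvN
    exact one_ne_zero (eigen a 1 0 (by simpa using ha) (by simpa using hb))
  have kerW : N.comap (LinearMap.inr F V W) = ⊥ := by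
    refine (hWirr _ fun m x hx => by simpa using invN m _ hx).resolve_right fun h => ?_
    have hwN : (w : W) ∈ N.comap (LinearMap.inr F V W) := h ▸ Submodule.mem_top
    obtain ⟨a, ha, hb⟩ := memN _ hwN
    exact zero_ne_one (eigen a 0 1 (by simpa using ha) (by simpa using hb))
  have rangeV : N.map (LinearMap.fst F V W) = ⊤ := by
    refine (hVirr _ ?_).resolve_left fun h => hv0 ?_
    · rintro m _ ⟨z, hz, rfl⟩
      exact ⟨_, invN m z hz, rfl⟩
    · exact (Submodule.mem_bot F).1 (h ▸ Submodule.mem_map_of_mem vwN)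
  have rangeW : N.map (LinearMap.snd F V W) = ⊤ := by
    refine (hWirr _ ?_).resolve_left fun h => hw0 ?_
    · rintro m _ ⟨z, hz, rfl⟩
      exact ⟨_, invN m z hz, rfl⟩
    · exact (Submodule.mem_bot F).1 (h ▸ Submodule.mem_map_of_mem vwN)
  have bijV : Function.Bijective ((LinearMap.fst F V W).domRestrict N) := by
    constructor
    · refine (injective_iff_map_eq_zero _).2 ?_
      rintro ⟨⟨x, y⟩, hz⟩ (rfl : x = 0)
      have hy : y ∈ N.comap (LinearMap.inr F V W) := hz
      rw [kerW, Submodule.mem_bot] at hy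
      simp [hy]
    · intro x
      obtain ⟨z, hz, rfl⟩ : x ∈ N.map (LinearMap.fst F V W) := rangeV ▸ Submodule.mem_top
      exact ⟨⟨z, hz⟩, rfl⟩
  have bijW : Function.Bijective ((LinearMap.snd F V W).domRestrict N) := by
    constructor
    · refine (injective_iff_map_eq_zero _).2 ?_
      rintro ⟨⟨x, y⟩, hz⟩ (rfl : y = 0)
      have hx : x ∈ N.comap (LinearMap.inl F V W) := hz
      rw [kerV, Submodule.mem_bot] at hx
      simp [hx]
    · intro y
      obtain ⟨z, hz, rfl⟩ : y ∈ N.map (LinearMap.snd F V W) := rangeW ▸ Submodule.mem_top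
      exact ⟨⟨z, hz⟩, rfl⟩
  let eV := LinearEquiv.ofBijective _ bijV
  let eW := LinearEquiv.ofBijective _ bijW
  refine ⟨eV.symm.trans eW, fun m x => ?_⟩
  obtain ⟨z, rfl⟩ := eV.surjective x
  have h : π m (eV z) = eV ⟨_, invN m z z.2⟩ := rfl
  rw [h, LinearEquiv.trans_apply, LinearEquiv.trans_apply, eV.symm_apply_apply,
    eV.symm_apply_apply]
  rfl
end

section
/- Let M be a finite monoid, N a submonoid of M, F a field, (π, V) a representation of N over F, and (σ, W) a representation of M over F. If φ ∈ Hom_M(W, Ind_N^M V), then the map F(φ) : W → V defined by F(φ)(w) = φ(w)(1) (evaluation at the identity of M) is F-linear and satisfies F(φ)(σ(n)w) = π(n)F(φ)(w) for all n ∈ N, i.e. F(φ) ∈ Hom_N(W, V); moreover φ ↦ F(φ) is F-linear. -/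
/-- The induced representation space `Ind_N^M V` as a subspace of `M → V`. -/
def IndRep {M : Type*} [Monoid M] (N : Submonoid M) (F : Type*) [Field F]
    {V : Type*} [AddCommGroup V] [Module F V] (π : N →* Module.End F V) :
    Submodule F (M → V) where
  carrier := {f : M → V | ∀ (n : N) (m : M), f ((n : M) * m) = π n (f m)}
  add_mem' := by
    intro f g hf hg n m
    simp only [Set.mem_setOf_eq] at *
    simp [hf n m, hg n m]
  zero_mem' := by intro n m; simp
  smul_mem' := by
    intro c f hf n m
    simp only [Set.mem_setOf_eq] at *
    simp [hf n m]

/-- The space of `M`-equivariant linear maps `W → Ind_N^M V`. -/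
def HomM {M : Type*} [Monoid M] (N : Submonoid M) {F : Type*} [Field F]
    {V W : Type*} [AddCommGroup V] [Module F V] [AddCommGroup W] [Module F W]
    (π : N →* Module.End F V) (σ : M →* Module.End F W) :
    Submodule F (W →ₗ[F] ↥(IndRep N F π)) where
  carrier := {φ | ∀ (m : M) (w : W),
    ((φ (σ m w) : M → V)) = fun x => (φ w : M → V) (x * m)}
  add_mem' := by
    intro φ ψ hφ hψ m w
    funext x
    simp only [Set.mem_setOf_eq] at hφ hψ
    simp [hφ m w, hψ m w]
  zero_mem' := by intro m w; funext x; simp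
  smul_mem' := by
    intro c φ hφ m w
    funext x
    simp only [Set.mem_setOf_eq] at hφ
    simp [hφ m w]

/-- The space of `N`-equivariant linear maps `W → V`. -/
def HomN {M : Type*} [Monoid M] (N : Submonoid M) {F : Type*} [Field F]
    {V W : Type*} [AddCommGroup V] [Module F V] [AddCommGroup W] [Module F W]
    (π : N →* Module.End F V) (σ : M →* Module.End F W) :
    Submodule F (W →ₗ[F] V) where
  carrier := {τ | ∀ (n : N) (w : W), τ (σ (n : M) w) = π n (τ w)}
  add_mem' := by
    intro τ η hτ hη n w
    simp only [Set.mem_setOf_eq] at hτ hη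
    simp [hτ n w, hη n w]
  zero_mem' := by intro n w; simp
  smul_mem' := by
    intro c τ hτ n w
    simp only [Set.mem_setOf_eq] at hτ
    simp [hτ n w]

/-- For `φ ∈ Hom_M(W, Ind_N^M V)`, the map `F(φ) : w ↦ φ(w)(1)` is `F`-linear and
`N`-equivariant, i.e. `F(φ) ∈ Hom_N(W, V)`; moreover `φ ↦ F(φ)` is itself `F`-linear.
(Here this is expressed by exhibiting the `F`-linear map `Φ` on the submodule `Hom_M`
sending `φ` to the linear map `w ↦ φ(w)(1)` landing in `Hom_N`.) -/
theorem evaluation_at_one_into_HomN {M : Type*} [Monoid M] [Fintype M]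
    {F : Type*} [Field F]
    {V W : Type*} [AddCommGroup V] [Module F V] [AddCommGroup W] [Module F W]
    (N : Submonoid M) (π : N →* Module.End F V) (σ : M →* Module.End F W) :
    ∃ Φ : ↥(HomM N π σ) →ₗ[F] (W →ₗ[F] V),
      ∀ φ : ↥(HomM N π σ),
        (∀ w : W, Φ φ w = ((φ : W →ₗ[F] ↥(IndRep N F π)) w : M → V) 1) ∧
        Φ φ ∈ HomN N π σ := by
  let Φ : ↥(HomM N π σ) →ₗ[F] (W →ₗ[F] V) :=
    { toFun := fun φ =>
        LinearMap.proj 1 ∘ₗ (IndRep N F π).subtype ∘ₗ (φ : W →ₗ[F] ↥(IndRep N F π))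
      map_add' := fun _ _ => rfl
      map_smul' := fun _ _ => rfl }
  refine ⟨Φ, fun φ => ⟨fun _ => rfl, fun n w => ?_⟩⟩
  change ((φ : W →ₗ[F] ↥(IndRep N F π)) (σ n w) : M → V) 1 =
    π n (((φ : W →ₗ[F] ↥(IndRep N F π)) w : M → V) 1)
  rw [φ.2 n w, ← (φ.1 w).2 n 1]
  simp only [one_mul, mul_one]
end

section
/- Let M be a finite monoid, N a submonoid of M, F a field, (π, V) a representation of N over F, and (σ, W) a representation of M over F. If τ ∈ Hom_N(W, V), then the map G(τ) : W → (M → V) defined by G(τ)(w)(m) = τ(σ(m)w) takes values in Ind_N^M V (i.e. G(τ)(w)(nm) = π(n)G(τ)(w)(m) for all n ∈ N, m ∈ M), is F-linear in w, and satisfies G(τ)(σ(x)w) = π^M(x)(G(τ)(w)) for all x ∈ M; i.e. G(τ) ∈ Hom_M(W, Ind_N^M V). Moreover τ ↦ G(τ) is F-linear. -/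
/-- For `τ ∈ Hom_N(W, V)`, the map `G(τ) : w ↦ (m ↦ τ(σ(m)w))` takes values in
`Ind_N^M V`, is `F`-linear in `w`, and is `M`-equivariant, i.e. `G(τ) ∈ Hom_M(W, Ind_N^M V)`;
moreover `τ ↦ G(τ)` is itself `F`-linear.  (Here this is expressed by exhibiting the
`F`-linear map `Γ` on the submodule `Hom_N` sending `τ` to the linear map
`w ↦ (m ↦ τ(σ(m)w))`, with values in `Ind_N^M V`, landing in `Hom_M`.) -/
theorem induction_map_into_HomM {M : Type*} [Monoid M] [Fintype M]
    {F : Type*} [Field F]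
    {V W : Type*} [AddCommGroup V] [Module F V] [AddCommGroup W] [Module F W]
    (N : Submonoid M) (π : N →* Module.End F V) (σ : M →* Module.End F W) :
    ∃ Γ : ↥(HomN N π σ) →ₗ[F] (W →ₗ[F] ↥(IndRep N F π)),
      ∀ τ : ↥(HomN N π σ),
        (∀ (w : W) (m : M), ((Γ τ w : M → V)) m = (τ : W →ₗ[F] V) (σ m w)) ∧
        Γ τ ∈ HomM N π σ := by
  refine ⟨{
    toFun := fun τ =>
      { toFun := fun w => ⟨fun m => (τ : W →ₗ[F] V) (σ m w), fun n m => by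
          simp only [map_mul, Module.End.mul_apply]
          exact τ.2 n (σ m w)⟩
        map_add' := fun _ _ => by ext; simp
        map_smul' := fun _ _ => by ext; simp }
    map_add' := fun _ _ => rfl
    map_smul' := fun _ _ => rfl }, fun τ => ⟨fun _ _ => rfl, fun m w => ?_⟩⟩
  funext x
  simp
end
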